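/- arXiv:2011.09511 — 5 statements merged into one kernel-verified Lean document; each statement's English description precedes it below -/
import Mathlib

section
/- Let x : U → ℝ³ be a proper frontal and Ω a tmb of x. Then: (1) k_{1Ω} = λ_Ω · k₁ and k_{2Ω} = λ_Ω · k₂ at every point of the complement of Σ(x); (2) for every p ∈ Σ(x), k_{1Ω}(p) = lim_{(u,v)→p, (u,v)∈Σ(x)ᶜ} λ_Ω(u,v) k₁(u,v) and k_{2Ω}(p) = lim_{(u,v)→p, (u,v)∈Σ(x)ᶜ} λ_Ω(u,v) k₂(u,v). -/
/- Common framework for frontals and tangent moving bases, following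
   "Curvatures on fronts" conventions. -/

noncomputable section

open Matrix Topology Filter

/-- Points of the plane ℝ². -/
abbrev Pt : Type := Fin 2 → ℝ

/-- Jacobian matrix of a map `f : ℝ² → ℝ^m` at a point. -/
def jac {m : ℕ} (f : Pt → (Fin m → ℝ)) (p : Pt) : Matrix (Fin m) (Fin 2) ℝ :=
  Matrix.of fun i j => fderiv ℝ f p (Pi.single j 1) i

/-- Euclidean norm of a vector in ℝ³. -/
def enorm3 (v : Fin 3 → ℝ) : ℝ := Real.sqrt (v ⬝ᵥ v)

/-- The unit normal vector field induced by a tangent moving base `Ω`,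
    `n := (w₁ × w₂)/‖w₁ × w₂‖` where `w₁, w₂` are the columns of `Ω`. -/
def normalOf (Ω : Pt → Matrix (Fin 3) (Fin 2) ℝ) (p : Pt) : Fin 3 → ℝ :=
  (enorm3 (crossProduct (fun i => Ω p i 0) (fun i => Ω p i 1)))⁻¹ •
    crossProduct (fun i => Ω p i 0) (fun i => Ω p i 1)

/-- First fundamental form matrix of a map `y`. -/
def IOf (y : Pt → Fin 3 → ℝ) (p : Pt) : Matrix (Fin 2) (Fin 2) ℝ :=
  (jac y p)ᵀ * jac y p

/-- Second fundamental form matrix of a map `y` with respect to a unit normal `ν`. -/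
def IIOf (y ν : Pt → Fin 3 → ℝ) (p : Pt) : Matrix (Fin 2) (Fin 2) ℝ :=
  -((jac y p)ᵀ * jac ν p)

/-- Weingarten matrix `α := −IIᵀ I⁻¹` of a map `y` with unit normal `ν`. -/
def weinOf (y ν : Pt → Fin 3 → ℝ) (p : Pt) : Matrix (Fin 2) (Fin 2) ℝ :=
  -((IIOf y ν p)ᵀ * (IOf y p)⁻¹)

/-- Gaussian curvature of an immersion `y` with unit normal `ν`. -/
def KgOf (y ν : Pt → Fin 3 → ℝ) (p : Pt) : ℝ :=
  (IIOf y ν p).det / (IOf y p).det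

/-- Mean curvature of an immersion `y` with unit normal `ν`. -/
def HmOf (y ν : Pt → Fin 3 → ℝ) (p : Pt) : ℝ :=
  -(1 / 2) * (weinOf y ν p).trace

/-- Smaller principal curvature `H − √(H² − K)` of an immersion `y`. -/
def k1Of (y ν : Pt → Fin 3 → ℝ) (p : Pt) : ℝ :=
  HmOf y ν p - Real.sqrt ((HmOf y ν p) ^ 2 - KgOf y ν p)

/-- Larger principal curvature `H + √(H² − K)` of an immersion `y`. -/
def k2Of (y ν : Pt → Fin 3 → ℝ) (p : Pt) : ℝ :=
  HmOf y ν p + Real.sqrt ((HmOf y ν p) ^ 2 - KgOf y ν p)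

/-- A frontal `x : U → ℝ³` equipped with a tangent moving base (tmb) `Ω` and the
induced smooth matrix-valued maps `Λ`, `μ` satisfying `Dx = Ω Λᵀ` and `Dn = Ω μᵀ` on `U`. -/
structure Frontal where
  /-- the domain -/
  U : Set Pt
  isOpen_U : IsOpen U
  /-- the frontal -/
  x : Pt → Fin 3 → ℝ
  /-- the tangent moving base -/
  Ω : Pt → Matrix (Fin 3) (Fin 2) ℝ
  /-- `Λ` with `Dx = Ω Λᵀ` -/
  Λ : Pt → Matrix (Fin 2) (Fin 2) ℝ
  /-- `μ` with `Dn = Ω μᵀ` -/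
  μ : Pt → Matrix (Fin 2) (Fin 2) ℝ
  smooth_x : ContDiffOn ℝ (⊤ : ℕ∞) x U
  smooth_Ω : ∀ i j, ContDiffOn ℝ (⊤ : ℕ∞) (fun p => Ω p i j) U
  smooth_Λ : ∀ i j, ContDiffOn ℝ (⊤ : ℕ∞) (fun p => Λ p i j) U
  smooth_μ : ∀ i j, ContDiffOn ℝ (⊤ : ℕ∞) (fun p => μ p i j) U
  /-- the columns of `Ω` are linearly independent (nonzero cross product) -/
  indep : ∀ p ∈ U, crossProduct (fun i => Ω p i 0) (fun i => Ω p i 1) ≠ 0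
  decomp_x : ∀ p ∈ U, jac x p = Ω p * (Λ p)ᵀ
  decomp_n : ∀ p ∈ U, jac (normalOf Ω) p = Ω p * (μ p)ᵀ

namespace Frontal

variable (F : Frontal)

/-- The unit normal induced by the tmb. -/
def n : Pt → Fin 3 → ℝ := normalOf F.Ω

/-- `λ_Ω := det Λ`. -/
def lam (p : Pt) : ℝ := (F.Λ p).det

/-- The Ω-relative curvature `K_Ω := det μ`. -/
def KΩ (p : Pt) : ℝ := (F.μ p).det

/-- `α_Ω := μ · adj(Λ)`. -/
def αΩ (p : Pt) : Matrix (Fin 2) (Fin 2) ℝ := F.μ p * (F.Λ p).adjugate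

/-- The Ω-relative mean curvature `H_Ω := −(1/2) tr α_Ω`. -/
def HΩ (p : Pt) : ℝ := -(1 / 2) * (F.αΩ p).trace

/-- The relative principal curvature `k_{1Ω} := H_Ω − √(H_Ω² − λ_Ω K_Ω)`. -/
def k1Ω (p : Pt) : ℝ := F.HΩ p - Real.sqrt ((F.HΩ p) ^ 2 - F.lam p * F.KΩ p)

/-- The relative principal curvature `k_{2Ω} := H_Ω + √(H_Ω² − λ_Ω K_Ω)`. -/
def k2Ω (p : Pt) : ℝ := F.HΩ p + Real.sqrt ((F.HΩ p) ^ 2 - F.lam p * F.KΩ p)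

/-- The singular set `Σ(x) = λ_Ω⁻¹(0)`. -/
def sing : Set Pt := {p ∈ F.U | F.lam p = 0}

/-- The regular set `U − Σ(x)`. -/
def reg : Set Pt := {p ∈ F.U | F.lam p ≠ 0}

/-- A frontal is proper if its singular set has empty interior. -/
def IsProper : Prop := interior F.sing = ∅

/-- `x` is a wavefront if `(x, n) : U → ℝ³ × S²` is an immersion. -/
def IsWavefront : Prop :=
  ∀ p ∈ F.U, (Matrix.fromRows (jac F.x p) (jac F.n p)).rank = 2

/-- First fundamental form matrix `I = Dxᵀ Dx`. -/
def Imat (p : Pt) : Matrix (Fin 2) (Fin 2) ℝ := IOf F.x p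

/-- Second fundamental form matrix `II = −Dxᵀ Dn`. -/
def IImat (p : Pt) : Matrix (Fin 2) (Fin 2) ℝ := IIOf F.x F.n p

/-- Weingarten matrix `α := −IIᵀ I⁻¹` (meaningful off the singular set). -/
def Wein (p : Pt) : Matrix (Fin 2) (Fin 2) ℝ := weinOf F.x F.n p

/-- Coefficient `e` of the second fundamental form. -/
def e (p : Pt) : ℝ := F.IImat p 0 0

/-- Coefficient `f` of the second fundamental form. -/
def f (p : Pt) : ℝ := F.IImat p 0 1

/-- Coefficient `g` of the second fundamental form. -/
def g (p : Pt) : ℝ := F.IImat p 1 1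

/-- Gaussian curvature (meaningful off the singular set). -/
def Kg (p : Pt) : ℝ := KgOf F.x F.n p

/-- Mean curvature (meaningful off the singular set). -/
def Hm (p : Pt) : ℝ := HmOf F.x F.n p

/-- Principal curvature `κ₋ := H − √(H² − K)`. -/
def κm (p : Pt) : ℝ := F.Hm p - Real.sqrt ((F.Hm p) ^ 2 - F.Kg p)

/-- Principal curvature `κ₊ := H + √(H² − K)`. -/
def κp (p : Pt) : ℝ := F.Hm p + Real.sqrt ((F.Hm p) ^ 2 - F.Kg p)

/-- `k₁ := κ₋` where `λ_Ω > 0` and `k₁ := κ₊` where `λ_Ω < 0`. -/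
def k1 (p : Pt) : ℝ := if 0 < F.lam p then F.κm p else F.κp p

/-- `k₂ := κ₊` where `λ_Ω > 0` and `k₂ := κ₋` where `λ_Ω < 0`. -/
def k2 (p : Pt) : ℝ := if 0 < F.lam p then F.κp p else F.κm p

/-- `x` is parallelly smoothable at `p` : for some `ε > 0` and some open
neighborhood `V` of `p`, `rank D(x + l·n)(q) = 2` for all `(q,l) ∈ V × (0,ε)`
or for all `(q,l) ∈ V × (−ε,0)`. -/
def ParSmoothable (p : Pt) : Prop :=
  ∃ ε > (0 : ℝ), ∃ V : Set Pt, IsOpen V ∧ p ∈ V ∧ V ⊆ F.U ∧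
    ((∀ q ∈ V, ∀ l ∈ Set.Ioo (0 : ℝ) ε,
        (jac (fun z => F.x z + l • F.n z) q).rank = 2) ∨
     (∀ q ∈ V, ∀ l ∈ Set.Ioo (-ε) (0 : ℝ),
        (jac (fun z => F.x z + l • F.n z) q).rank = 2))

/-- `f` (defined off the singular set) has a `C^∞` extension to `V`. -/
def SmoothExtOn (f : Pt → ℝ) (V : Set Pt) : Prop :=
  ∃ g : Pt → ℝ, ContDiffOn ℝ (⊤ : ℕ∞) g V ∧ ∀ q ∈ V ∩ F.reg, g q = f q

/-- `f` has a `C^∞` extension to some open neighborhood of `p`. -/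
def SmoothExtNear (f : Pt → ℝ) (p : Pt) : Prop :=
  ∃ V : Set Pt, IsOpen V ∧ p ∈ V ∧ V ⊆ F.U ∧ F.SmoothExtOn f V

/-- Membership in the principal ideal `𝔗_Ω(V)` generated by `λ_Ω` in `C^∞(V,ℝ)`. -/
def memIdeal (f : Pt → ℝ) (V : Set Pt) : Prop :=
  ∃ φ : Pt → ℝ, ContDiffOn ℝ (⊤ : ℕ∞) φ V ∧ ∀ q ∈ V, f q = φ q * F.lam q

end Frontal

/-- `f` does not change sign on `V`. -/
def NoSignChange (f : Pt → ℝ) (V : Set Pt) : Prop :=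
  (∀ q ∈ V, 0 ≤ f q) ∨ (∀ q ∈ V, f q ≤ 0)

/-- Lagrange's identity for the Gram determinant of the columns of a `3 × 2` matrix. -/
theorem det_transpose_mul_self_eq_cross_dot_cross (A : Matrix (Fin 3) (Fin 2) ℝ) :
    (Aᵀ * A).det = crossProduct (fun i => A i 0) (fun i => A i 1) ⬝ᵥ
      crossProduct (fun i => A i 0) (fun i => A i 1) := by
  rw [cross_dot_cross, Matrix.det_fin_two]
  simp only [Matrix.mul_apply, Matrix.transpose_apply, dotProduct]

namespace Frontal

variable {F : Frontal} {p : Pt}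

theorem isUnit_det_gram (hp : p ∈ F.U) : IsUnit ((F.Ω p)ᵀ * F.Ω p).det := by
  rw [det_transpose_mul_self_eq_cross_dot_cross, isUnit_iff_ne_zero]
  exact fun h => F.indep p hp (dotProduct_self_eq_zero.mp h)

theorem IOf_eq (hp : p ∈ F.U) :
    IOf F.x p = F.Λ p * ((F.Ω p)ᵀ * F.Ω p) * (F.Λ p)ᵀ := by
  rw [IOf, F.decomp_x p hp, Matrix.transpose_mul, Matrix.transpose_transpose]
  simp only [Matrix.mul_assoc]

theorem IIOf_eq (hp : p ∈ F.U) :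
    IIOf F.x F.n p = -(F.Λ p * ((F.Ω p)ᵀ * F.Ω p) * (F.μ p)ᵀ) := by
  rw [IIOf, n, F.decomp_x p hp, F.decomp_n p hp, Matrix.transpose_mul,
    Matrix.transpose_transpose]
  simp only [Matrix.mul_assoc]

theorem weinOf_eq (hp : p ∈ F.reg) : weinOf F.x F.n p = F.μ p * (F.Λ p)⁻¹ := by
  have hG := isUnit_det_gram hp.1
  have hL : IsUnit (F.Λ p)ᵀ.det := by
    rw [Matrix.det_transpose]
    exact isUnit_iff_ne_zero.mpr hp.2
  rw [weinOf, IOf_eq hp.1, IIOf_eq hp.1, Matrix.transpose_neg, Matrix.neg_mul, neg_neg,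
    Matrix.mul_inv_rev, Matrix.mul_inv_rev]
  simp only [Matrix.transpose_mul, Matrix.transpose_transpose]
  set G := (F.Ω p)ᵀ * F.Ω p
  rw [Matrix.mul_assoc (F.μ p), Matrix.mul_assoc G, Matrix.mul_nonsing_inv_cancel_left _ _ hL,
    Matrix.mul_nonsing_inv_cancel_left _ _ hG]

theorem lam_mul_Hm (hp : p ∈ F.reg) : F.lam p * F.Hm p = F.HΩ p := by
  have hl : F.lam p ≠ 0 := hp.2
  rw [Hm, HmOf, weinOf_eq hp, HΩ, αΩ, Matrix.inv_def, Ring.inverse_eq_inv', Matrix.mul_smul,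
    Matrix.trace_smul, smul_eq_mul, ← lam]
  field_simp

theorem lam_mul_Kg (hp : p ∈ F.reg) : F.lam p * F.Kg p = F.KΩ p := by
  have hl : (F.Λ p).det ≠ 0 := hp.2
  have hG := (isUnit_det_gram hp.1).ne_zero
  rw [Kg, KgOf, IOf_eq hp.1, IIOf_eq hp.1, Matrix.det_neg, Fintype.card_fin, lam, KΩ]
  rw [Matrix.det_mul _ (F.Λ p)ᵀ, Matrix.det_mul _ (F.μ p)ᵀ, Matrix.det_mul (F.Λ p),
    Matrix.det_transpose (F.Λ p), Matrix.det_transpose (F.μ p)]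
  field_simp

theorem sqrt_discr_eq (hp : p ∈ F.reg) :
    Real.sqrt (F.HΩ p ^ 2 - F.lam p * F.KΩ p) =
      |F.lam p| * Real.sqrt (F.Hm p ^ 2 - F.Kg p) := by
  rw [← lam_mul_Hm hp, ← lam_mul_Kg hp, ← Real.sqrt_sq_eq_abs,
    ← Real.sqrt_mul (sq_nonneg _)]
  ring_nf

theorem k1Ω_eq_lam_mul_k1 (hp : p ∈ F.reg) : F.k1Ω p = F.lam p * F.k1 p := by
  rw [k1Ω, sqrt_discr_eq hp, ← lam_mul_Hm hp, k1]
  split_ifs with h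
  · rw [abs_of_pos h, κm]; ring
  · rw [abs_of_nonpos (not_lt.mp h), κp]; ring

theorem k2Ω_eq_lam_mul_k2 (hp : p ∈ F.reg) : F.k2Ω p = F.lam p * F.k2 p := by
  rw [k2Ω, sqrt_discr_eq hp, ← lam_mul_Hm hp, k2]
  split_ifs with h
  · rw [abs_of_pos h, κp]; ring
  · rw [abs_of_nonpos (not_lt.mp h), κm]; ring

theorem continuousOn_Λ : ContinuousOn F.Λ F.U :=
  continuousOn_pi.mpr fun i => continuousOn_pi.mpr fun j => (F.smooth_Λ i j).continuousOn

theorem continuousOn_μ : ContinuousOn F.μ F.U :=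
  continuousOn_pi.mpr fun i => continuousOn_pi.mpr fun j => (F.smooth_μ i j).continuousOn

theorem continuousOn_HΩ : ContinuousOn F.HΩ F.U := by
  have hΛ := continuousOn_iff_continuous_domRestrict.mp (continuousOn_Λ (F := F))
  have hμ := continuousOn_iff_continuous_domRestrict.mp (continuousOn_μ (F := F))
  exact continuousOn_iff_continuous_domRestrict.mpr
    (continuous_const.mul (hμ.matrix_mul hΛ.matrix_adjugate).matrix_trace)

theorem continuousOn_sqrt_discr :
    ContinuousOn (fun q => Real.sqrt (F.HΩ q ^ 2 - F.lam q * F.KΩ q)) F.U := by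
  have hdet : Continuous fun A : Matrix (Fin 2) (Fin 2) ℝ => A.det := continuous_id.matrix_det
  have hlam : ContinuousOn F.lam F.U := hdet.comp_continuousOn continuousOn_Λ
  have hK : ContinuousOn F.KΩ F.U := hdet.comp_continuousOn continuousOn_μ
  exact ((continuousOn_HΩ.pow 2).sub (hlam.mul hK)).sqrt

theorem continuousOn_k1Ω : ContinuousOn F.k1Ω F.U :=
  continuousOn_HΩ.sub continuousOn_sqrt_discr

theorem continuousOn_k2Ω : ContinuousOn F.k2Ω F.U :=
  continuousOn_HΩ.add continuousOn_sqrt_discr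

theorem tendsto_nhdsWithin_reg {f g : Pt → ℝ} (hf : ContinuousOn f F.U) (hp : p ∈ F.U)
    (hfg : Set.EqOn f g F.reg) : Tendsto g (nhdsWithin p F.reg) (nhds (f p)) :=
  ((hf p hp).mono_left (nhdsWithin_mono p fun _ hq => hq.1)).congr'
    (eventually_nhdsWithin_of_forall hfg)

end Frontal

/-- For a proper frontal, `k_{iΩ} = λ_Ω k_i` on the regular set, and
at each singular point `k_{iΩ}(p)` is the limit of `λ_Ω k_i` through the regular set. -/
theorem stmt1 (F : Frontal) (hP : F.IsProper) :
    (∀ p ∈ F.reg, F.k1Ω p = F.lam p * F.k1 p ∧ F.k2Ω p = F.lam p * F.k2 p) ∧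
    (∀ p ∈ F.sing,
      Tendsto (fun q => F.lam q * F.k1 q) (nhdsWithin p F.reg) (nhds (F.k1Ω p)) ∧
      Tendsto (fun q => F.lam q * F.k2 q) (nhdsWithin p F.reg) (nhds (F.k2Ω p))) := by
  refine ⟨fun p hp => ⟨Frontal.k1Ω_eq_lam_mul_k1 hp, Frontal.k2Ω_eq_lam_mul_k2 hp⟩,
    fun p hp => ⟨?_, ?_⟩⟩
  · exact Frontal.tendsto_nhdsWithin_reg Frontal.continuousOn_k1Ω hp.1
      fun _ hq => Frontal.k1Ω_eq_lam_mul_k1 hq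
  · exact Frontal.tendsto_nhdsWithin_reg Frontal.continuousOn_k2Ω hp.1
      fun _ hq => Frontal.k2Ω_eq_lam_mul_k2 hq
end
end

section
/- Let x : U → ℝ³ be a wavefront and Ω a tmb of x. For each p ∈ Σ(x) there exist a real number l > 0 and an open neighborhood V ⊆ U of p such that y_l := x + l·n restricted to V is an embedding, Dy_l is a tmb of x on V, and the matrix Λ_{Dy_l} determined by this tmb equals 𝕀 − l·α_l, where α_l is the Weingarten matrix of the immersion y_l and 𝕀 is the 2×2 identity matrix. -/
/- Common framework for frontals and tangent moving bases, following
   "Curvatures on fronts" conventions. -/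

noncomputable section

open Matrix Topology Filter

theorem jac_mulVec {m : ℕ} (f : Pt → Fin m → ℝ) (p v : Pt) : jac f p *ᵥ v = fderiv ℝ f p v := by
  have hv : v = ∑ j, v j • (Pi.single j 1 : Pt) := by
    ext i; fin_cases i <;> simp [Fin.sum_univ_two]
  conv_rhs => rw [hv]
  ext i
  simp [mulVec, dotProduct, jac, mul_comm]

theorem jac_add_smul {m : ℕ} {f g : Pt → Fin m → ℝ} {p : Pt} (hf : DifferentiableAt ℝ f p)
    (hg : DifferentiableAt ℝ g p) (l : ℝ) :
    jac (fun z => f z + l • g z) p = jac f p + l • jac g p := by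
  ext i j
  simp only [jac, of_apply, fderiv_fun_add hf (hg.fun_const_smul l), fderiv_fun_const_smul hg]
  rfl

theorem jac_const_smul {m : ℕ} {f : Pt → Fin m → ℝ} {p : Pt} (hf : DifferentiableAt ℝ f p)
    (c : ℝ) : jac (fun z => c • f z) p = c • jac f p := by
  ext i j
  simp [jac, fderiv_fun_const_smul hf]

theorem det_transpose_mul_self_pos {W : Matrix (Fin 3) (Fin 2) ℝ}
    (hW : crossProduct (fun i => W i 0) (fun i => W i 1) ≠ 0) : 0 < (Wᵀ * W).det := by
  have h : (Wᵀ * W).det = crossProduct (fun i => W i 0) (fun i => W i 1) ⬝ᵥ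
      crossProduct (fun i => W i 0) (fun i => W i 1) := by
    rw [cross_dot_cross]
    simp [det_fin_two, mul_apply, dotProduct, Fin.sum_univ_three]
  rw [h]
  refine lt_of_le_of_ne (Finset.sum_nonneg fun i _ => mul_self_nonneg _) ?_
  rwa [ne_comm, Ne, dotProduct_self_eq_zero]

theorem crossProduct_mul_transpose (W : Matrix (Fin 3) (Fin 2) ℝ) (A : Matrix (Fin 2) (Fin 2) ℝ) :
    crossProduct (fun i => (W * Aᵀ) i 0) (fun i => (W * Aᵀ) i 1) =
      A.det • crossProduct (fun i => W i 0) (fun i => W i 1) := by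
  ext k
  fin_cases k <;> simp [cross_apply, mul_apply, det_fin_two] <;> ring

theorem enorm3_smul (c : ℝ) (v : Fin 3 → ℝ) : enorm3 (c • v) = |c| * enorm3 v := by
  rw [enorm3, smul_dotProduct, dotProduct_smul, smul_smul, smul_eq_mul,
    Real.sqrt_mul (mul_self_nonneg c), Real.sqrt_mul_self_eq_abs, enorm3]

theorem normalOf_eq_sign_smul {Ω Ω' : Pt → Matrix (Fin 3) (Fin 2) ℝ} {q : Pt}
    {A : Matrix (Fin 2) (Fin 2) ℝ} (h : Ω' q = Ω q * Aᵀ) :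
    normalOf Ω' q = (|A.det|⁻¹ * A.det) • normalOf Ω q := by
  simp only [normalOf, h, crossProduct_mul_transpose, enorm3_smul, smul_smul, mul_inv]
  congr 1
  ring

theorem rank_eq_two_of_det_ne_zero {m : Type*} [Fintype m] {B : Matrix m (Fin 2) ℝ}
    (h : (Bᵀ * B).det ≠ 0) : B.rank = 2 := by
  rw [← rank_transpose_mul_self, rank_of_isUnit _ ((isUnit_iff_isUnit_det _).2 h.isUnit)]
  simp

theorem det_ne_zero_of_rank_eq_two {m : Type*} [Fintype m] {B : Matrix m (Fin 2) ℝ}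
    (h : B.rank = 2) : (Bᵀ * B).det ≠ 0 := by
  rw [← rank_transpose_mul_self] at h
  have hli := Matrix.linearIndependent_rows_iff_isUnit (A := Bᵀ * B)
  refine ((isUnit_iff_isUnit_det _).1 (hli.1 ?_)).ne_zero
  rw [linearIndependent_iff_card_eq_finrank_span, Set.finrank, ← rank_eq_finrank_span_row, h]
  simp

/-- If `(x, n)` has injective differential and `DxᵀDn` is symmetric, the pencil `det (L + l M)`
does not vanish identically: up to the Gram determinant, `det (L + i M)` has squared modulus
`det (DxᵀDx + DnᵀDn)`. -/
theorem exists_pos_det_add_smul_ne_zero {W : Matrix (Fin 3) (Fin 2) ℝ}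
    {L M : Matrix (Fin 2) (Fin 2) ℝ} (hdet : L.det = 0)
    (hsymm : ((W * Lᵀ)ᵀ * (W * Mᵀ)).IsSymm)
    (hrank : (fromRows (W * Lᵀ) (W * Mᵀ)).rank = 2) :
    ∃ l : ℝ, 0 < l ∧ (L + l • M).det ≠ 0 := by
  by_contra! hcon
  have h1 := hcon 1 one_pos
  have h2 := hcon 2 two_pos
  apply det_ne_zero_of_rank_eq_two hrank
  have hs := hsymm.apply 0 1
  rw [transpose_fromRows, fromCols_mul_fromRows]
  have hG : ∃ G : Matrix (Fin 2) (Fin 2) ℝ, G = Wᵀ * W ∧ G 1 0 = G 0 1 :=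
    ⟨_, rfl, by simp [mul_apply, mul_comm]⟩
  obtain ⟨G, hG, hG'⟩ := hG
  have hform (A B : Matrix (Fin 2) (Fin 2) ℝ) : (W * Aᵀ)ᵀ * (W * Bᵀ) = A * G * Bᵀ := by
    rw [hG, transpose_mul, transpose_transpose]
    simp only [Matrix.mul_assoc]
  rw [hform] at hs
  rw [hform, hform]
  have hT : L 0 0 * M 1 1 + M 0 0 * L 1 1 - L 0 1 * M 1 0 - M 0 1 * L 1 0 = 0 := by
    simp only [det_fin_two, Matrix.add_apply, Matrix.smul_apply, smul_eq_mul] at h1 h2 hdet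
    linarith
  have hM : M.det = 0 := by
    simp only [det_fin_two, Matrix.add_apply, Matrix.smul_apply, smul_eq_mul] at h1 h2 hdet ⊢
    linarith
  simp only [det_fin_two, Matrix.add_apply, mul_apply, Fin.sum_univ_two, transpose_apply, hG']
    at hs hdet hM ⊢
  set k := (L 1 0 * G 0 0 + L 1 1 * G 0 1) * M 0 0 + (L 1 0 * G 0 1 + L 1 1 * G 1 1) * M 0 1 -
    ((L 0 0 * G 0 0 + L 0 1 * G 0 1) * M 1 0 + (L 0 0 * G 0 1 + L 0 1 * G 1 1) * M 1 1) with hk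
  have hk0 : k = 0 := by linarith
  have key := congrArg (fun t => t * t) hk0
  simp only [hk] at key
  linear_combination key + (G 0 0 * G 1 1 - G 0 1 * G 0 1) *
    ((L 0 0 * M 1 1 + M 0 0 * L 1 1 - L 0 1 * M 1 0 - M 0 1 * L 1 0) * hT +
    (L 0 0 * L 1 1 - L 0 1 * L 1 0 - (M 0 0 * M 1 1 - M 0 1 * M 1 0)) * (hdet - hM))

theorem HasStrictFDerivAt.exists_isOpen_isEmbedding {E G : Type*} [NormedAddCommGroup E]
    [NormedSpace ℝ E] [FiniteDimensional ℝ E] [NormedAddCommGroup G] [NormedSpace ℝ G]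
    [FiniteDimensional ℝ G] {f : E → G} {f' : E →L[ℝ] G} {a : E} {U : Set E}
    (hf : HasStrictFDerivAt f f' a) (hinj : Function.Injective f') (hU : IsOpen U) (ha : a ∈ U)
    (hcont : ContinuousOn f U) :
    ∃ V : Set E, IsOpen V ∧ a ∈ V ∧ V ⊆ U ∧ Topology.IsEmbedding (V.domRestrict f) := by
  obtain ⟨g, hg⟩ := LinearMap.exists_leftInverse_of_injective (f' : E →ₗ[ℝ] G)
    (LinearMap.ker_eq_bot.2 hinj)
  have hcomp : HasStrictFDerivAt (g.toContinuousLinearMap ∘ f)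
      ((ContinuousLinearEquiv.refl ℝ E : E ≃L[ℝ] E) : E →L[ℝ] E) a := by
    have h := g.toContinuousLinearMap.hasStrictFDerivAt.comp a hf
    rwa [show g.toContinuousLinearMap.comp f' = (ContinuousLinearEquiv.refl ℝ E : E →L[ℝ] E) from
      ContinuousLinearMap.ext fun v => LinearMap.congr_fun hg v] at h
  have := FiniteDimensional.complete ℝ E
  set e := hcomp.toOpenPartialHomeomorph _
  refine ⟨U ∩ e.source, hU.inter e.open_source,
    ⟨ha, hcomp.mem_toOpenPartialHomeomorph_source⟩, Set.inter_subset_left, ?_⟩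
  refine Topology.IsEmbedding.of_comp (g := g.toContinuousLinearMap)
    (hcont.mono Set.inter_subset_left).domRestrict g.toContinuousLinearMap.continuous ?_
  exact e.isOpenEmbedding_restrict.isEmbedding.comp
    (Topology.IsEmbedding.inclusion (Set.inter_subset_right : U ∩ e.source ⊆ e.source))

theorem normalOf_dotProduct_mulVec (Ω : Pt → Matrix (Fin 3) (Fin 2) ℝ) (q : Pt)
    (v : Fin 2 → ℝ) : (Ω q *ᵥ v) ⬝ᵥ normalOf Ω q = 0 := by
  rw [normalOf, dotProduct_smul]
  simp only [mulVec, dotProduct, cross_apply, Fin.sum_univ_three, Fin.sum_univ_two, smul_eq_mul]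
  simp
  right
  ring

theorem ContDiffOn.det_fin_two {A : Pt → Matrix (Fin 2) (Fin 2) ℝ} {s : Set Pt}
    (hA : ∀ i j, ContDiffOn ℝ (⊤ : ℕ∞) (fun p => A p i j) s) :
    ContDiffOn ℝ (⊤ : ℕ∞) (fun p => (A p).det) s := by
  simp only [Matrix.det_fin_two]
  exact ((hA 0 0).mul (hA 1 1)).sub ((hA 0 1).mul (hA 1 0))

theorem ContDiffOn.inv_fin_two {A : Pt → Matrix (Fin 2) (Fin 2) ℝ} {s : Set Pt}
    (hA : ∀ i j, ContDiffOn ℝ (⊤ : ℕ∞) (fun p => A p i j) s) (h : ∀ p ∈ s, (A p).det ≠ 0)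
    (i j : Fin 2) : ContDiffOn ℝ (⊤ : ℕ∞) (fun p => (A p)⁻¹ i j) s := by
  simp only [Matrix.inv_def, Ring.inverse_eq_inv', Matrix.smul_apply, smul_eq_mul]
  refine ((ContDiffOn.det_fin_two hA).inv h).mul ?_
  simp only [Matrix.adjugate_fin_two]
  fin_cases i <;> fin_cases j
  · exact hA 1 1
  · exact (hA 0 1).neg
  · exact (hA 1 0).neg
  · exact hA 0 0

theorem ContDiffOn.matrix_mul {l m k : Type*} [Fintype m] {A : Pt → Matrix l m ℝ}
    {B : Pt → Matrix m k ℝ} {s : Set Pt}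
    (hA : ∀ i j, ContDiffOn ℝ (⊤ : ℕ∞) (fun p => A p i j) s)
    (hB : ∀ i j, ContDiffOn ℝ (⊤ : ℕ∞) (fun p => B p i j) s) (i : l) (j : k) :
    ContDiffOn ℝ (⊤ : ℕ∞) (fun p => (A p * B p) i j) s := by
  simp only [Matrix.mul_apply]
  exact ContDiffOn.sum fun a _ => (hA i a).mul (hB a j)

theorem contDiffOn_normalOf {Ω : Pt → Matrix (Fin 3) (Fin 2) ℝ} {s : Set Pt}
    (hΩ : ∀ i j, ContDiffOn ℝ (⊤ : ℕ∞) (fun p => Ω p i j) s)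
    (hne : ∀ p ∈ s, crossProduct (fun i => Ω p i 0) (fun i => Ω p i 1) ≠ 0) :
    ContDiffOn ℝ (⊤ : ℕ∞) (normalOf Ω) s := by
  have hc : ContDiffOn ℝ (⊤ : ℕ∞)
      (fun p => crossProduct (fun i => Ω p i 0) (fun i => Ω p i 1)) s := by
    rw [contDiffOn_pi]
    intro k
    simp only [cross_apply]
    fin_cases k
    · exact ((hΩ 1 0).mul (hΩ 2 1)).sub ((hΩ 2 0).mul (hΩ 1 1))
    · exact ((hΩ 2 0).mul (hΩ 0 1)).sub ((hΩ 0 0).mul (hΩ 2 1))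
    · exact ((hΩ 0 0).mul (hΩ 1 1)).sub ((hΩ 1 0).mul (hΩ 0 1))
  have hd : ∀ p ∈ s, crossProduct (fun i => Ω p i 0) (fun i => Ω p i 1) ⬝ᵥ
      crossProduct (fun i => Ω p i 0) (fun i => Ω p i 1) ≠ 0 :=
    fun p hp h => hne p hp (dotProduct_self_eq_zero.1 h)
  refine ContDiffOn.smul (ContDiffOn.inv (ContDiffOn.sqrt ?_ hd) fun p hp => ?_) hc
  · exact ContDiffOn.sum fun i _ => (contDiffOn_pi.1 hc i).mul (contDiffOn_pi.1 hc i)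
  · exact (Real.sqrt_ne_zero (Finset.sum_nonneg fun i _ => mul_self_nonneg _)).2 (hd p hp)

/-- The second fundamental form of a map orthogonal to `ν` is symmetric. -/
theorem isSymm_jac_transpose_mul_jac {f ν : Pt → Fin 3 → ℝ} {p : Pt}
    (hf : ContDiffAt ℝ 2 f p) (hν : DifferentiableAt ℝ ν p)
    (h : ∀ᶠ q in 𝓝 p, ∀ v, fderiv ℝ f q v ⬝ᵥ ν q = 0) :
    ((jac f p)ᵀ * jac ν p).IsSymm := by
  have hf' : DifferentiableAt ℝ (fderiv ℝ f) p :=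
    (hf.fderiv_right (m := 1) (by norm_num)).differentiableAt one_ne_zero
  have hsymm := hf.isSymmSndFDerivAt (by simp)
  have hprod (v w : Pt) : fderiv ℝ (fderiv ℝ f) p w v ⬝ᵥ ν p +
      fderiv ℝ f p v ⬝ᵥ fderiv ℝ ν p w = 0 := by
    have hd (i : Fin 3) : HasFDerivAt (fun q => fderiv ℝ f q v i)
        ((ContinuousLinearMap.proj (R := ℝ) (φ := fun _ : Fin 3 => ℝ) i).comp
          ((fderiv ℝ (fderiv ℝ f) p).flip v)) p :=
      (ContinuousLinearMap.proj (R := ℝ) (φ := fun _ : Fin 3 => ℝ) i).hasFDerivAt.comp p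
        (by simpa using hf'.hasFDerivAt.clm_apply (hasFDerivAt_const v p))
    have hn (i : Fin 3) : HasFDerivAt (fun q => ν q i)
        ((ContinuousLinearMap.proj (R := ℝ) (φ := fun _ : Fin 3 => ℝ) i).comp
          (fderiv ℝ ν p)) p :=
      (ContinuousLinearMap.proj (R := ℝ) (φ := fun _ : Fin 3 => ℝ) i).hasFDerivAt.comp p
        hν.hasFDerivAt
    have hsum := HasFDerivAt.fun_sum (u := Finset.univ) fun i _ => (hd i).mul (hn i)
    have hzero : HasFDerivAt (fun q => ∑ i, fderiv ℝ f q v i * ν q i) (0 : Pt →L[ℝ] ℝ) p :=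
      (hasFDerivAt_const (0 : ℝ) p).congr_of_eventuallyEq (h.mono fun q hq => hq v)
    have := DFunLike.congr_fun (hsum.unique hzero) w
    simp [Fin.sum_univ_three, dotProduct] at this ⊢
    linarith
  ext i j
  have h1 := hprod (Pi.single i 1) (Pi.single j 1)
  have h2 := hprod (Pi.single j 1) (Pi.single i 1)
  rw [hsymm (Pi.single i 1) (Pi.single j 1)] at h2
  simp only [transpose_apply, mul_apply, jac, of_apply]
  simp only [dotProduct] at h1 h2
  linarith

/-- If `Dν = Dy Mᵀ` for an immersion `y`, then `M` is its Weingarten matrix. -/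
theorem weinOf_eq {y ν : Pt → Fin 3 → ℝ} {q : Pt} {M : Matrix (Fin 2) (Fin 2) ℝ}
    (hdet : (IOf y q).det ≠ 0) (h : jac ν q = jac y q * Mᵀ) : weinOf y ν q = M := by
  have hII : (IIOf y ν q)ᵀ = -(M * IOf y q) := by
    simp [IIOf, IOf, h, transpose_mul, Matrix.mul_assoc]
  rw [weinOf, hII, Matrix.neg_mul, neg_neg, Matrix.mul_assoc, mul_nonsing_inv _ hdet.isUnit,
    Matrix.mul_one]

namespace Frontal

variable (F : Frontal)

theorem contDiffOn_n : ContDiffOn ℝ (⊤ : ℕ∞) F.n F.U := contDiffOn_normalOf F.smooth_Ω F.indep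

theorem jac_parallel {q : Pt} (hq : q ∈ F.U) (l : ℝ) :
    jac (fun z => F.x z + l • F.n z) q = F.Ω q * (F.Λ q + l • F.μ q)ᵀ := by
  have hU := F.isOpen_U.mem_nhds hq
  rw [jac_add_smul ((F.smooth_x.contDiffAt hU).differentiableAt (by simp))
    ((F.contDiffOn_n.contDiffAt hU).differentiableAt (by simp)), F.decomp_x q hq,
    show jac F.n q = _ from F.decomp_n q hq, transpose_add, transpose_smul, Matrix.mul_add,
    Matrix.mul_smul]

theorem isSymm_jac_x_transpose_mul_jac_n {p : Pt} (hp : p ∈ F.U) :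
    ((jac F.x p)ᵀ * jac F.n p).IsSymm := by
  have hU := F.isOpen_U.mem_nhds hp
  refine isSymm_jac_transpose_mul_jac ((F.smooth_x.contDiffAt hU).of_le (WithTop.coe_le_coe.2 le_top))
    ((F.contDiffOn_n.contDiffAt hU).differentiableAt (by simp)) ?_
  filter_upwards [hU] with q hq v
  rw [← jac_mulVec, F.decomp_x q hq, ← mulVec_mulVec]
  exact normalOf_dotProduct_mulVec _ _ _

end Frontal

/-- On a wavefront, near each singular point there is `l > 0` such
that `y_l = x + l·n` is an embedding on a neighborhood `V`, `Dy_l` is a tmb of `x`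
on `V`, and the corresponding matrix `Λ_{Dy_l}` is `𝕀 − l·α_l` where `α_l` is the
Weingarten matrix of `y_l`. -/
theorem stmt3 (F : Frontal) (hW : F.IsWavefront) :
    ∀ p ∈ F.sing, ∃ l : ℝ, 0 < l ∧ ∃ V : Set Pt, IsOpen V ∧ p ∈ V ∧ V ⊆ F.U ∧
      -- `y_l` restricted to `V` is an embedding (an embedded immersed surface)
      Topology.IsEmbedding (fun q : V => F.x q + l • F.n q) ∧
      (∀ q ∈ V, (jac (fun z => F.x z + l • F.n z) q).rank = 2) ∧
      -- `Dy_l` is a tmb of `x` on `V`, and the induced `Λ` equals `𝕀 − l·α_l`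
      (∃ G : Frontal, G.U = V ∧ G.x = F.x ∧
        G.Ω = (fun q => jac (fun z => F.x z + l • F.n z) q) ∧
        ∀ q ∈ V, G.Λ q = 1 - l • weinOf (fun z => F.x z + l • F.n z) F.n q) := by
  intro p hp
  obtain ⟨hpU, hlam⟩ := hp
  have hrank := hW p hpU
  have hsymm := F.isSymm_jac_x_transpose_mul_jac_n hpU
  rw [F.decomp_x p hpU, show jac F.n p = _ from F.decomp_n p hpU] at hrank hsymm
  obtain ⟨l, hl, hdet⟩ := exists_pos_det_add_smul_ne_zero hlam hsymm hrank
  set y : Pt → Fin 3 → ℝ := fun z => F.x z + l • F.n z with hy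
  set A : Pt → Matrix (Fin 2) (Fin 2) ℝ := fun q => F.Λ q + l • F.μ q with hA
  have hysm : ContDiffOn ℝ (⊤ : ℕ∞) y F.U := F.smooth_x.add (F.contDiffOn_n.const_smul l)
  have hAsm (i j) : ContDiffOn ℝ (⊤ : ℕ∞) (fun q => A q i j) F.U :=
    (F.smooth_Λ i j).add ((F.smooth_μ i j).const_smul l)
  have hjac {q : Pt} (hq : q ∈ F.U) : jac y q = F.Ω q * (A q)ᵀ := F.jac_parallel hq l
  have hIdet {q : Pt} (hq : q ∈ F.U) (h : (A q).det ≠ 0) : (IOf y q).det ≠ 0 := by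
    refine (det_transpose_mul_self_pos ?_).ne'
    rw [hjac hq, crossProduct_mul_transpose]
    exact smul_ne_zero h (F.indep q hq)
  set c : ℝ := |(A p).det|⁻¹ * (A p).det with hc
  -- on `W` the normal induced by `Dy` is the constant multiple `c = ±1` of `n`
  set W : Set Pt := F.U ∩ (fun q => (A p).det * (A q).det) ⁻¹' Set.Ioi 0 with hWdef
  have hWo : IsOpen W := ((continuousOn_const.mul
    (ContDiffOn.det_fin_two hAsm).continuousOn).isOpen_inter_preimage F.isOpen_U isOpen_Ioi)
  have hpW : p ∈ W := ⟨hpU, mul_self_pos.2 hdet⟩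
  have hWdet {q : Pt} (hq : q ∈ W) : (A q).det ≠ 0 := fun h => by
    have := hq.2
    simp [h] at this
  have hnormal {q : Pt} (hq : q ∈ W) : normalOf (jac y) q = c • F.n q := by
    rw [normalOf_eq_sign_smul (hjac hq.1), hc]
    congr 1
    rcases pos_and_pos_or_neg_and_neg_of_mul_pos
        (show 0 < (A p).det * (A q).det from hq.2) with ⟨h1, h2⟩ | ⟨h1, h2⟩
    · rw [abs_of_pos h1, abs_of_pos h2, inv_mul_cancel₀ h1.ne', inv_mul_cancel₀ h2.ne']
    · rw [abs_of_neg h1, abs_of_neg h2, inv_neg, inv_neg, neg_mul, neg_mul,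
        inv_mul_cancel₀ h1.ne, inv_mul_cancel₀ h2.ne]
  have hinj : Function.Injective (fderiv ℝ y p) := by
    intro v w hvw
    rw [← jac_mulVec, ← jac_mulVec] at hvw
    have := congrArg (fun u => (IOf y p)⁻¹ *ᵥ ((jac y p)ᵀ *ᵥ u)) hvw
    simp only [mulVec_mulVec] at this
    rw [show (jac y p)ᵀ * jac y p = IOf y p from rfl,
      nonsing_inv_mul _ (hIdet hpU hdet).isUnit, one_mulVec, one_mulVec] at this
    exact this
  obtain ⟨V, hVo, hpV, hVW, hemb⟩ := HasStrictFDerivAt.exists_isOpen_isEmbedding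
    ((hysm.contDiffAt (F.isOpen_U.mem_nhds hpU)).hasStrictFDerivAt (by simp)) hinj hWo hpW
    (hysm.continuousOn.mono Set.inter_subset_left)
  have hVU : V ⊆ F.U := hVW.trans Set.inter_subset_left
  have hAinv {q : Pt} (hq : q ∈ V) : F.Ω q = jac y q * ((A q)⁻¹)ᵀ := by
    rw [hjac (hVU hq), Matrix.mul_assoc, ← transpose_mul,
      nonsing_inv_mul _ (hWdet (hVW hq)).isUnit, transpose_one, Matrix.mul_one]
  have hjn {q : Pt} (hq : q ∈ V) : jac F.n q = jac y q * (F.μ q * (A q)⁻¹)ᵀ := by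
    rw [transpose_mul, ← Matrix.mul_assoc, ← hAinv hq]
    exact F.decomp_n q (hVU hq)
  have hAinvsm := ContDiffOn.inv_fin_two (fun i j => (hAsm i j).mono hVU)
    (fun q hq => hWdet (hVW hq))
  have hμAsm := ContDiffOn.matrix_mul (fun i j => (F.smooth_μ i j).mono hVU) hAinvsm
  refine ⟨l, hl, V, hVo, hpV, hVU, hemb,
    fun q hq => rank_eq_two_of_det_ne_zero (hIdet (hVU hq) (hWdet (hVW hq))), ?_⟩
  refine ⟨{
    U := V
    isOpen_U := hVo
    x := F.x
    Ω := fun q => jac y q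
    Λ := fun q => F.Λ q * (A q)⁻¹
    μ := fun q => c • (F.μ q * (A q)⁻¹)
    smooth_x := F.smooth_x.mono hVU
    smooth_Ω := fun i j => ?_
    smooth_Λ := ContDiffOn.matrix_mul (fun i j => (F.smooth_Λ i j).mono hVU) hAinvsm
    smooth_μ := fun i j => (hμAsm i j).const_smul c
    indep := fun q hq => ?_
    decomp_x := fun q hq => ?_
    decomp_n := fun q hq => ?_ }, rfl, rfl, rfl, fun q hq => ?_⟩
  · exact (ContDiffOn.matrix_mul F.smooth_Ω (fun i j => hAsm j i) i j).mono hVU |>.congr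
      fun q hq => by rw [hjac (hVU hq)]; rfl
  · rw [hjac (hVU hq), crossProduct_mul_transpose]
    exact smul_ne_zero (hWdet (hVW hq)) (F.indep q (hVU hq))
  · rw [transpose_mul, ← Matrix.mul_assoc, ← hAinv hq]
    exact F.decomp_x q (hVU hq)
  · have hev : normalOf (jac y) =ᶠ[𝓝 q] fun z => c • F.n z := by
      filter_upwards [hVo.mem_nhds hq] with z hz using hnormal (hVW hz)
    have hn := (F.contDiffOn_n.contDiffAt (F.isOpen_U.mem_nhds (hVU hq))).differentiableAt
      (by simp)
    rw [transpose_smul, Matrix.mul_smul, ← hjn hq, ← jac_const_smul hn]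
    ext i j
    exact congrArg (fun D : Pt →L[ℝ] Fin 3 → ℝ => D (Pi.single j 1) i) hev.fderiv_eq
  · rw [weinOf_eq (hIdet (hVU hq) (hWdet (hVW hq))) (hjn hq), eq_sub_iff_add_eq,
      ← Matrix.smul_mul, ← Matrix.add_mul]
    exact mul_nonsing_inv _ (hWdet (hVW hq)).isUnit
end
end

section
/- Let x : U → ℝ³ be a wavefront, p ∈ Σ(x), and let Ω = Dy_l be a tmb of x on a neighborhood V of p, where l > 0 and y_l := x + l·n restricted to V is an embedding. Then: (a) K_Ω = K_l, H_Ω = H_l + K_l·l, and λ_Ω = 1 + 2H_l·l + K_l·l² on V; (b) k_{1Ω} = k_{1l}(1 + l·k_{2l}) and k_{2Ω} = k_{2l}(1 + l·k_{1l}) on V, where K_l, H_l and k_{1l} := H_l − √(H_l² − K_l), k_{2l} := H_l + √(H_l² − K_l) are the Gaussian curvature, mean curvature and principal curvatures of the immersion y_l. -/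
/- Common framework for frontals and tangent moving bases, following
   "Curvatures on fronts" conventions. -/

noncomputable section

open Matrix Topology Filter

/-- The normal induced by `Ω` is orthogonal to the columns of `Ω`. -/
theorem normalOf_dotProduct_col (Ω : Pt → Matrix (Fin 3) (Fin 2) ℝ) (p : Pt) (j : Fin 2) :
    ∑ i, normalOf Ω p i * Ω p i j = 0 := by
  fin_cases j <;> simp [normalOf, Fin.sum_univ_three, crossProduct] <;> ring

theorem contDiffAt_normalOf {Ω : Pt → Matrix (Fin 3) (Fin 2) ℝ} {q : Pt}
    (hΩ : ∀ i j, ContDiffAt ℝ (⊤ : ℕ∞) (fun p => Ω p i j) q)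
    (hq : crossProduct (fun i => Ω q i 0) (fun i => Ω q i 1) ≠ 0) :
    ContDiffAt ℝ (⊤ : ℕ∞) (normalOf Ω) q := by
  have hc : ∀ i, ContDiffAt ℝ (⊤ : ℕ∞)
      (fun p => crossProduct (fun i => Ω p i 0) (fun i => Ω p i 1) i) q := by
    intro i
    fin_cases i <;> simp only [crossProduct, LinearMap.mk₂_apply] <;>
      exact ((hΩ _ _).mul (hΩ _ _)).sub ((hΩ _ _).mul (hΩ _ _))
  have hd : ContDiffAt ℝ (⊤ : ℕ∞)
      (fun p => crossProduct (fun i => Ω p i 0) (fun i => Ω p i 1) ⬝ᵥ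
        crossProduct (fun i => Ω p i 0) (fun i => Ω p i 1)) q :=
    ContDiffAt.sum fun i _ => (hc i).mul (hc i)
  have h0 : crossProduct (fun i => Ω q i 0) (fun i => Ω q i 1) ⬝ᵥ
        crossProduct (fun i => Ω q i 0) (fun i => Ω q i 1) ≠ 0 :=
    fun h => hq (dotProduct_self_eq_zero.mp h)
  have hs : enorm3 (crossProduct (fun i => Ω q i 0) (fun i => Ω q i 1)) ≠ 0 := by
    have h := dotProduct_self_star_nonneg
      (crossProduct (fun i => Ω q i 0) (fun i => Ω q i 1))
    rw [star_trivial] at h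
    exact (Real.sqrt_pos.mpr (lt_of_le_of_ne h h0.symm)).ne'
  exact ((hd.sqrt h0).inv hs).smul (contDiffAt_pi.mpr hc)

/-- Relative to a base that is locally the Jacobian of a `C²` map, the second fundamental form
is symmetric. -/
theorem jac_normalOf_transpose_mul_isSymm {Ω : Pt → Matrix (Fin 3) (Fin 2) ℝ}
    {y : Pt → Fin 3 → ℝ} {q : Pt} (hy : ContDiffAt ℝ 2 y q)
    (hn : DifferentiableAt ℝ (normalOf Ω) q) (hΩ : ∀ᶠ z in 𝓝 q, Ω z = jac y z) :
    ((jac (normalOf Ω) q)ᵀ * Ω q).IsSymm := by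
  have hsymm : IsSymmSndFDerivAt ℝ y q := hy.isSymmSndFDerivAt (by simp)
  have hD : DifferentiableAt ℝ (fderiv ℝ y) q :=
    (hy.fderiv_right (m := 1) (by norm_num)).differentiableAt (by norm_num)
  have hni : ∀ i, HasFDerivAt (fun z => normalOf Ω z i)
      ((ContinuousLinearMap.proj (R := ℝ) i).comp (fderiv ℝ (normalOf Ω) q)) q :=
    fun i => (hasFDerivAt_pi'.mp hn.hasFDerivAt) i
  have hyi : ∀ i j, HasFDerivAt (fun z => fderiv ℝ y z (Pi.single j 1) i)
      ((ContinuousLinearMap.proj (R := ℝ) i).comp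
        ((fderiv ℝ (fderiv ℝ y) q).flip (Pi.single j 1))) q := by
    intro i j
    have h := hD.hasFDerivAt.clm_apply (hasFDerivAt_const (Pi.single j (1 : ℝ) : Pt) q)
    have h' := (hasFDerivAt_pi'.mp h) i
    simpa using h'
  have key : ∀ j k, ∑ i, fderiv ℝ (normalOf Ω) q (Pi.single k 1) i * Ω q i j =
      -∑ i, normalOf Ω q i * fderiv ℝ (fderiv ℝ y) q (Pi.single k 1) (Pi.single j 1) i := by
    intro j k
    have h1 := HasFDerivAt.fun_sum (u := Finset.univ) fun i _ => (hni i).mul (hyi i j)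
    have h2 : (fun z => ∑ i, normalOf Ω z i * fderiv ℝ y z (Pi.single j 1) i) =ᶠ[𝓝 q]
        fun _ => (0 : ℝ) := by
      filter_upwards [hΩ] with z hz
      rw [← normalOf_dotProduct_col Ω z j]
      simp [hz, jac]
    have h3 := h1.unique ((hasFDerivAt_const (0 : ℝ) q).congr_of_eventuallyEq h2)
    have h4 := DFunLike.congr_fun h3 (Pi.single k 1)
    simp only [_root_.sum_apply, _root_.add_apply,
      _root_.smul_apply, ContinuousLinearMap.comp_apply,
      ContinuousLinearMap.proj_apply, ContinuousLinearMap.flip_apply,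
      _root_.zero_apply, smul_eq_mul, Finset.sum_add_distrib] at h4
    rw [hΩ.self_of_nhds]
    simp only [jac, Matrix.of_apply]
    rw [eq_neg_iff_add_eq_zero, add_comm, ← h4]
    simp only [mul_comm]
  ext k j
  simp only [Matrix.transpose_apply, Matrix.mul_apply]
  simp only [jac, Matrix.of_apply]
  rw [key, key]
  simp only [hsymm.eq (Pi.single j 1) (Pi.single k 1)]

/-- A real `2 × 2` matrix that is self-adjoint for a Gram form has nonnegative discriminant. -/
theorem four_mul_det_le_trace_sq {B : Matrix (Fin 3) (Fin 2) ℝ} {M : Matrix (Fin 2) (Fin 2) ℝ}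
    (hB : (Bᵀ * B).det ≠ 0) (hM : (M * (Bᵀ * B)).IsSymm) : 4 * M.det ≤ M.trace ^ 2 := by
  have h := hM.apply 0 1
  simp only [Matrix.mul_apply, Matrix.transpose_apply, Fin.sum_univ_two,
    Fin.sum_univ_three] at h
  simp only [Matrix.det_fin_two, Matrix.mul_apply, Matrix.transpose_apply,
    Fin.sum_univ_three] at hB
  rw [Matrix.det_fin_two, Matrix.trace_fin_two]
  have hE : 0 < B 0 0 * B 0 0 + B 1 0 * B 1 0 + B 2 0 * B 2 0 := by
    refine lt_of_le_of_ne
      (add_nonneg (add_nonneg (mul_self_nonneg _) (mul_self_nonneg _)) (mul_self_nonneg _))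
      fun h0 => hB ?_
    have h1 : B 0 0 = 0 := by nlinarith [sq_nonneg (B 0 0), sq_nonneg (B 1 0), sq_nonneg (B 2 0)]
    have h2 : B 1 0 = 0 := by nlinarith [sq_nonneg (B 0 0), sq_nonneg (B 1 0), sq_nonneg (B 2 0)]
    have h3 : B 2 0 = 0 := by nlinarith [sq_nonneg (B 0 0), sq_nonneg (B 1 0), sq_nonneg (B 2 0)]
    simp [h1, h2, h3]
  have hsq : (B 0 0 * B 0 0 + B 1 0 * B 1 0 + B 2 0 * B 2 0) *
      ((M 0 0 + M 1 1) ^ 2 - 4 * (M 0 0 * M 1 1 - M 0 1 * M 1 0)) =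
      ((M 0 0 - M 1 1) * B 0 0 + 2 * M 0 1 * B 0 1) ^ 2 +
      ((M 0 0 - M 1 1) * B 1 0 + 2 * M 0 1 * B 1 1) ^ 2 +
      ((M 0 0 - M 1 1) * B 2 0 + 2 * M 0 1 * B 2 1) ^ 2 := by
    linear_combination (4 * M 0 1) * h
  have := nonneg_of_mul_nonneg_right (hsq.ge.trans' (by positivity)) hE
  linarith

theorem isUnit_gram_of_rank_eq_two {B : Matrix (Fin 3) (Fin 2) ℝ} (hB : B.rank = 2) :
    IsUnit (Bᵀ * B) := by
  rw [← Matrix.linearIndependent_cols_iff_isUnit, linearIndependent_iff_card_eq_finrank_span,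
    Set.finrank, ← Matrix.rank_eq_finrank_span_cols, Matrix.rank_transpose_mul_self, hB,
    Fintype.card_fin]

/-- If `Ω = Dy_l` on `V` (with `y_l = x + l·n` an embedding on `V`),
then `K_Ω = K_l`, `H_Ω = H_l + K_l·l`, `λ_Ω = 1 + 2H_l·l + K_l·l²`, and
`k_{1Ω} = k_{1l}(1 + l·k_{2l})`, `k_{2Ω} = k_{2l}(1 + l·k_{1l})` on `V`. -/
theorem stmt4 (F : Frontal) (hW : F.IsWavefront) (p : Pt) (hp : p ∈ F.sing)
    (l : ℝ) (hl : 0 < l) (V : Set Pt) (hV : IsOpen V) (hpV : p ∈ V) (hVU : V ⊆ F.U)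
    (y : Pt → Fin 3 → ℝ) (hy : y = fun z => F.x z + l • F.n z)
    (hemb : Topology.IsEmbedding (fun q : V => y q))
    (himm : ∀ q ∈ V, (jac y q).rank = 2)
    (hΩ : ∀ q ∈ V, F.Ω q = jac y q) :
    ∀ q ∈ V,
      F.KΩ q = KgOf y F.n q ∧
      F.HΩ q = HmOf y F.n q + KgOf y F.n q * l ∧
      F.lam q = 1 + 2 * HmOf y F.n q * l + KgOf y F.n q * l ^ 2 ∧
      F.k1Ω q = k1Of y F.n q * (1 + l * k2Of y F.n q) ∧
      F.k2Ω q = k2Of y F.n q * (1 + l * k1Of y F.n q) := by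
  intro q hq
  have hqU := hVU hq
  have hUq := F.isOpen_U.mem_nhds hqU
  have hx : ContDiffAt ℝ (⊤ : ℕ∞) F.x q := F.smooth_x.contDiffAt hUq
  have hn : ContDiffAt ℝ (⊤ : ℕ∞) F.n q :=
    contDiffAt_normalOf (fun i j => (F.smooth_Ω i j).contDiffAt hUq) (F.indep q hqU)
  have hxd : DifferentiableAt ℝ F.x q := hx.differentiableAt (by simp)
  have hnd : DifferentiableAt ℝ F.n q := hn.differentiableAt (by simp)
  have hyc : ContDiffAt ℝ 2 y q := by
    rw [hy]
    exact (hx.add (hn.const_smul l)).of_le (WithTop.coe_le_coe.mpr le_top)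
  have hrank := himm q hq
  rw [← hΩ q hq] at hrank
  have hG := isUnit_gram_of_rank_eq_two hrank
  have hGdet : IsUnit ((F.Ω q)ᵀ * F.Ω q).det := (Matrix.isUnit_iff_isUnit_det _).mp hG
  have hjn : jac F.n q = F.Ω q * (F.μ q)ᵀ := F.decomp_n q hqU
  have hjy : F.Ω q = F.Ω q * (F.Λ q)ᵀ + l • (F.Ω q * (F.μ q)ᵀ) := by
    rw [← F.decomp_x q hqU, ← hjn, hΩ q hq, hy]
    ext i j
    have h : HasFDerivAt (fun z => F.x z + l • F.n z) (fderiv ℝ F.x q + l • fderiv ℝ F.n q) q :=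
      hxd.hasFDerivAt.add (hnd.hasFDerivAt.const_smul l)
    simp [jac, h.fderiv]
  have hΛ : F.Λ q = 1 - l • F.μ q := by
    have h1 : (F.Ω q)ᵀ * F.Ω q * ((F.Λ q)ᵀ + l • (F.μ q)ᵀ) = (F.Ω q)ᵀ * F.Ω q * 1 := by
      rw [Matrix.mul_one, Matrix.mul_assoc, Matrix.mul_add, Matrix.mul_smul, ← hjy]
    have h2 := congrArg Matrix.transpose (hG.mul_left_cancel h1)
    simp only [Matrix.transpose_add, Matrix.transpose_smul, Matrix.transpose_transpose,
      Matrix.transpose_one] at h2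
    exact eq_sub_of_add_eq h2
  have hII : IIOf y F.n q = -((F.Ω q)ᵀ * F.Ω q * (F.μ q)ᵀ) := by
    rw [IIOf, hjn, ← hΩ q hq, Matrix.mul_assoc]
  have hI : IOf y q = (F.Ω q)ᵀ * F.Ω q := by rw [IOf, ← hΩ q hq]
  have hK : KgOf y F.n q = (F.μ q).det := by
    rw [KgOf, hII, hI, Matrix.det_neg, Matrix.det_mul, Matrix.det_transpose, Fintype.card_fin]
    field_simp [hGdet.ne_zero]
  have hH : HmOf y F.n q = -(1 / 2) * (F.μ q).trace := by
    rw [HmOf, weinOf, hII, hI, Matrix.transpose_neg, Matrix.neg_mul, neg_neg,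
      Matrix.transpose_mul, Matrix.transpose_transpose, Matrix.transpose_mul,
      Matrix.transpose_transpose, Matrix.mul_nonsing_inv_cancel_right _ _ hGdet]
  have hsymm := jac_normalOf_transpose_mul_isSymm hyc hnd
    (Filter.eventually_of_mem (hV.mem_nhds hq) hΩ)
  rw [show jac (normalOf F.Ω) q = F.Ω q * (F.μ q)ᵀ from hjn, Matrix.transpose_mul,
    Matrix.transpose_transpose, Matrix.mul_assoc] at hsymm
  have hdisc : 0 ≤ HmOf y F.n q ^ 2 - KgOf y F.n q := by
    have := four_mul_det_le_trace_sq hGdet.ne_zero hsymm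
    rw [hH, hK]
    linarith
  have hKΩ : F.KΩ q = KgOf y F.n q := hK.symm
  have hHΩ : F.HΩ q = HmOf y F.n q + KgOf y F.n q * l := by
    rw [Frontal.HΩ, Frontal.αΩ, hΛ, hH, hK]
    simp [Matrix.adjugate_fin_two, Matrix.trace_fin_two, Matrix.det_fin_two, Matrix.mul_apply,
      Fin.sum_univ_two]
    ring
  have hlam : F.lam q = 1 + 2 * HmOf y F.n q * l + KgOf y F.n q * l ^ 2 := by
    rw [Frontal.lam, hΛ, hH, hK]
    simp [Matrix.trace_fin_two, Matrix.det_fin_two]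
    ring
  have hrel : F.HΩ q ^ 2 - F.lam q * F.KΩ q = HmOf y F.n q ^ 2 - KgOf y F.n q := by
    rw [hHΩ, hlam, hKΩ]
    ring
  have hsqrt := Real.sq_sqrt hdisc
  refine ⟨hKΩ, hHΩ, hlam, ?_, ?_⟩
  · rw [Frontal.k1Ω, hrel, hHΩ, k1Of, k2Of]
    linear_combination l * hsqrt
  · rw [Frontal.k2Ω, hrel, hHΩ, k1Of, k2Of]
    linear_combination l * hsqrt
end
end

section
/- Let x : U → ℝ³ be a proper wavefront, Ω a tmb of x, and p ∈ Σ(x) with rank(Dx(p)) = 1. Then (k_{1Ω}(p), k_{2Ω}(p)) ≠ (0,0); exactly one of k_{1Ω}(p), k_{2Ω}(p) is nonzero; and H_Ω(p) < 0 if and only if k_{1Ω}(p) ≠ 0, while H_Ω(p) > 0 if and only if k_{2Ω}(p) ≠ 0. -/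
/- Common framework for frontals and tangent moving bases, following
   "Curvatures on fronts" conventions. -/

noncomputable section

open Matrix Topology Filter

theorem eq_zero_of_mulVec_eq_zero_of_rank_eq_two {m : Type*} [Fintype m] (A : Matrix m (Fin 2) ℝ)
    (hA : A.rank = 2) (v : Fin 2 → ℝ) (hv : A *ᵥ v = 0) : v = 0 := by
  have h := LinearMap.finrank_range_add_finrank_ker A.mulVecLin
  rw [Module.finrank_fin_fun] at h
  have hA' : Module.finrank ℝ (LinearMap.range A.mulVecLin) = 2 := hA
  have hker : Module.finrank ℝ (LinearMap.ker A.mulVecLin) = 0 := by omega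
  have hbot := Submodule.finrank_eq_zero.mp hker
  have hmem : v ∈ LinearMap.ker A.mulVecLin := by simpa using hv
  rw [hbot] at hmem
  simpa using hmem

namespace Frontal

variable (F : Frontal)

theorem differentiableAt_n {p : Pt} (hp : p ∈ F.U) : DifferentiableAt ℝ F.n p := by
  have hΩ : ∀ i j, DifferentiableAt ℝ (fun q => F.Ω q i j) p := fun i j =>
    ((F.smooth_Ω i j).contDiffAt (F.isOpen_U.mem_nhds hp)).differentiableAt (by simp)
  have hc : DifferentiableAt ℝ
      (fun q => crossProduct (fun i => F.Ω q i 0) (fun i => F.Ω q i 1)) p := by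
    rw [differentiableAt_pi]
    intro i
    fin_cases i <;> simp [cross_apply] <;> fun_prop
  have hd : DifferentiableAt ℝ
      (fun q => crossProduct (fun i => F.Ω q i 0) (fun i => F.Ω q i 1) ⬝ᵥ
        crossProduct (fun i => F.Ω q i 0) (fun i => F.Ω q i 1)) p := by
    have hci := differentiableAt_pi.mp hc
    simp only [dotProduct]
    exact DifferentiableAt.fun_sum fun i _ => (hci i).mul (hci i)
  have h0 := mt dotProduct_self_eq_zero.mp (F.indep p hp)
  have hs := hd.sqrt h0
  refine DifferentiableAt.smul (hs.inv ?_) hc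
  have hpos := lt_of_le_of_ne (Finset.sum_nonneg fun i _ => mul_self_nonneg
    (crossProduct (fun i => F.Ω p i 0) (fun i => F.Ω p i 1) i)) (Ne.symm h0)
  exact (Real.sqrt_pos.mpr hpos).ne'

theorem fderiv_dotProduct_n {p : Pt} (hp : p ∈ F.U) (j : Fin 2) :
    fderiv ℝ F.x p (Pi.single j 1) ⬝ᵥ F.n p = 0 := by
  have h : fderiv ℝ F.x p (Pi.single j 1) = fun i => (F.Ω p * (F.Λ p)ᵀ) i j := by
    ext i
    rw [← F.decomp_x p hp]
    rfl
  rw [h]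
  simp only [n, normalOf, dotProduct_smul]
  simp [dotProduct, Fin.sum_univ_three, cross_apply, Matrix.mul_apply]
  right
  ring

/-- The second fundamental form is symmetric. -/
theorem fderiv_dotProduct_fderiv_n_comm {p : Pt} (hp : p ∈ F.U) (v w : Fin 2) :
    fderiv ℝ F.x p (Pi.single v 1) ⬝ᵥ fderiv ℝ F.n p (Pi.single w 1) =
      fderiv ℝ F.x p (Pi.single w 1) ⬝ᵥ fderiv ℝ F.n p (Pi.single v 1) := by
  have hx : ContDiffAt ℝ 2 F.x p := (F.smooth_x.contDiffAt (F.isOpen_U.mem_nhds hp)).of_le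
    (WithTop.coe_le_coe.mpr (le_top : (2 : ℕ∞) ≤ ⊤))
  have hdx : DifferentiableAt ℝ (fderiv ℝ F.x) p :=
    (hx.fderiv_right (m := 1) (by norm_num)).differentiableAt (by simp)
  have hn := F.differentiableAt_n hp
  have key : ∀ a b : Fin 2,
      fderiv ℝ F.x p (Pi.single a 1) ⬝ᵥ fderiv ℝ F.n p (Pi.single b 1) =
        - (fderiv ℝ (fderiv ℝ F.x) p (Pi.single b 1) (Pi.single a 1) ⬝ᵥ F.n p) := by
    intro a b
    have hxa : HasFDerivAt (fun q => fderiv ℝ F.x q (Pi.single a 1))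
        ((fderiv ℝ (fderiv ℝ F.x) p).flip (Pi.single a 1)) p := by
      simpa using hdx.hasFDerivAt.clm_apply (hasFDerivAt_const (Pi.single a 1 : Pt) p)
    have hxi := hasFDerivAt_pi'.mp hxa
    have hni := hasFDerivAt_pi'.mp hn.hasFDerivAt
    have hsum := HasFDerivAt.fun_sum (u := Finset.univ) fun i _ => (hxi i).mul (hni i)
    have hz : (fun q => ∑ i, fderiv ℝ F.x q (Pi.single a 1) i * F.n q i) =ᶠ[𝓝 p]
        fun _ => (0 : ℝ) := by
      filter_upwards [F.isOpen_U.mem_nhds hp] with q hq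
      exact F.fderiv_dotProduct_n hq a
    have huniq := hsum.unique ((hasFDerivAt_const (0 : ℝ) p).congr_of_eventuallyEq hz)
    have happ := congrArg (fun L : Pt →L[ℝ] ℝ => L (Pi.single b 1)) huniq
    simp [Fin.sum_univ_three] at happ
    simp only [dotProduct, Fin.sum_univ_three]
    linarith
  have hsymm := (hx.isSymmSndFDerivAt (by simp)).eq
    (Pi.single v 1) (Pi.single w 1)
  rw [key, key, hsymm]

theorem transpose_mul_comm_of_decomp {p : Pt} (hp : p ∈ F.U) :
    (F.Ω p * (F.Λ p)ᵀ)ᵀ * (F.Ω p * (F.μ p)ᵀ) =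
      (F.Ω p * (F.μ p)ᵀ)ᵀ * (F.Ω p * (F.Λ p)ᵀ) := by
  rw [← F.decomp_x p hp, ← F.decomp_n p hp]
  ext i j
  have h := F.fderiv_dotProduct_fderiv_n_comm hp i j
  rw [dotProduct_comm (fderiv ℝ F.x p (Pi.single j 1))] at h
  exact h

end Frontal

/-- If `Ω r` is orthogonal to `Ω w`, `w` is parallel to `r ≠ 0` and `Ω` has independent columns,
then `w = 0`. -/
theorem eq_zero_of_parallel_of_orthogonal (Ω : Matrix (Fin 3) (Fin 2) ℝ)
    (hΩ : crossProduct (fun i => Ω i 0) (fun i => Ω i 1) ≠ 0) (r w : Fin 2 → ℝ) (hr : r ≠ 0)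
    (hpar : w 0 * r 1 - w 1 * r 0 = 0) (horth : (Ω *ᵥ r) ⬝ᵥ (Ω *ᵥ w) = 0) : w = 0 := by
  have hinj : ∀ s : Fin 2 → ℝ, Ω *ᵥ s = 0 → s = 0 := by
    intro s hs
    have e : ∀ i, Ω i 0 * s 0 + Ω i 1 * s 1 = 0 := fun i => by
      simpa [Matrix.mulVec, dotProduct, Fin.sum_univ_two] using congrFun hs i
    by_contra hne
    apply hΩ
    have hk : ∀ (k : Fin 2) (a b : Fin 3), (Ω a 0 * Ω b 1 - Ω b 0 * Ω a 1) * s k = 0 := by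
      intro k a b
      fin_cases k
      · simp only [Fin.zero_eta]
        linear_combination Ω b 1 * e a - Ω a 1 * e b
      · simp only [Fin.mk_one]
        linear_combination Ω a 0 * e b - Ω b 0 * e a
    obtain ⟨k, hsk⟩ := Function.ne_iff.mp hne
    have hz : ∀ a b : Fin 3, Ω a 0 * Ω b 1 - Ω b 0 * Ω a 1 = 0 := fun a b =>
      (mul_eq_zero.mp (hk k a b)).resolve_right hsk
    ext i
    fin_cases i <;> simp [cross_apply]
    · linarith [hz 1 2]
    · linarith [hz 2 0]
    · linarith [hz 0 1]
  obtain ⟨t, ht⟩ : ∃ t : ℝ, w = t • r := by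
    obtain ⟨k, hk⟩ := Function.ne_iff.mp hr
    refine ⟨w k / r k, ?_⟩
    change r k ≠ 0 at hk
    ext i
    simp only [Pi.smul_apply, smul_eq_mul]
    field_simp
    fin_cases k <;> fin_cases i <;> simp <;> linarith
  rw [ht, Matrix.mulVec_smul, dotProduct_smul, smul_eq_mul] at horth
  rcases mul_eq_zero.mp horth with h | h
  · simp [ht, h]
  · exact absurd (hinj r (dotProduct_self_eq_zero.mp h)) hr

/-- A symmetric pair `(Λ, μ)` with `Λ ≠ 0` singular and `(Λᵀ, μᵀ)` jointly injective has
`tr (μ adj Λ) ≠ 0`. -/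
theorem trace_mul_adjugate_ne_zero (Ω : Matrix (Fin 3) (Fin 2) ℝ)
    (hΩ : crossProduct (fun i => Ω i 0) (fun i => Ω i 1) ≠ 0) (Λ μ : Matrix (Fin 2) (Fin 2) ℝ)
    (hΛ : Λ ≠ 0) (hdet : Λ.det = 0)
    (hsymm : (Ω * Λᵀ)ᵀ * (Ω * μᵀ) = (Ω * μᵀ)ᵀ * (Ω * Λᵀ))
    (hinj : ∀ v, Λᵀ *ᵥ v = 0 → μᵀ *ᵥ v = 0 → v = 0) :
    (μ * Λ.adjugate).trace ≠ 0 := by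
  intro htr
  obtain ⟨v, hv, hΛv⟩ := Matrix.exists_mulVec_eq_zero_iff.mpr
    (show Λᵀ.det = 0 by rw [Matrix.det_transpose, hdet])
  obtain ⟨i, hi⟩ := Function.ne_iff.mp hΛ
  refine hv (hinj v hΛv
    (eq_zero_of_parallel_of_orthogonal Ω hΩ (Λ i) (μᵀ *ᵥ v) hi ?_ ?_))
  · have e0 : Λ 0 0 * v 0 + Λ 1 0 * v 1 = 0 := by
      simpa [Matrix.mulVec, dotProduct, Fin.sum_univ_two] using congrFun hΛv 0
    have e1 : Λ 0 1 * v 0 + Λ 1 1 * v 1 = 0 := by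
      simpa [Matrix.mulVec, dotProduct, Fin.sum_univ_two] using congrFun hΛv 1
    simp [Matrix.trace, Matrix.mul_apply, Fin.sum_univ_two, Matrix.adjugate_fin_two] at htr
    fin_cases i <;> simp [Matrix.mulVec, dotProduct, Fin.sum_univ_two]
    · linear_combination (-v 1) * htr + μ 0 0 * e1 - μ 0 1 * e0
    · linear_combination v 0 * htr + μ 1 0 * e1 - μ 1 1 * e0
  · have h := congrFun (congrArg (fun A => A *ᵥ v) hsymm) i
    simp only [← Matrix.mulVec_mulVec, hΛv, Matrix.mulVec_zero] at h
    rw [Pi.zero_apply, Matrix.transpose_mul, Matrix.transpose_transpose,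
      ← Matrix.mulVec_mulVec] at h
    rw [← Matrix.vecMul_transpose, ← Matrix.dotProduct_mulVec]
    exact h

/-- At a rank-1 singularity of a proper wavefront,
`(k_{1Ω}(p), k_{2Ω}(p)) ≠ (0,0)`, exactly one of them is nonzero, and
`H_Ω(p) < 0 ↔ k_{1Ω}(p) ≠ 0`, `H_Ω(p) > 0 ↔ k_{2Ω}(p) ≠ 0`. -/
theorem stmt6 (F : Frontal) (hW : F.IsWavefront) (hP : F.IsProper)
    (p : Pt) (hp : p ∈ F.sing) (hr : (jac F.x p).rank = 1) :
    ¬(F.k1Ω p = 0 ∧ F.k2Ω p = 0) ∧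
    ((F.k1Ω p ≠ 0 ∧ F.k2Ω p = 0) ∨ (F.k1Ω p = 0 ∧ F.k2Ω p ≠ 0)) ∧
    (F.HΩ p < 0 ↔ F.k1Ω p ≠ 0) ∧
    (0 < F.HΩ p ↔ F.k2Ω p ≠ 0) := by
  obtain ⟨hpU, hlam⟩ := hp
  have hΛ : F.Λ p ≠ 0 := by
    intro h
    rw [F.decomp_x p hpU, h, Matrix.transpose_zero, Matrix.mul_zero, Matrix.rank_zero] at hr
    exact zero_ne_one hr
  have hinj : ∀ v, (F.Λ p)ᵀ *ᵥ v = 0 → (F.μ p)ᵀ *ᵥ v = 0 → v = 0 := by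
    intro v h1 h2
    refine eq_zero_of_mulVec_eq_zero_of_rank_eq_two _ (hW p hpU) v ?_
    rw [Matrix.fromRows_mulVec, Frontal.n, F.decomp_x p hpU, F.decomp_n p hpU,
      ← Matrix.mulVec_mulVec, ← Matrix.mulVec_mulVec, h1, h2]
    ext i
    cases i <;> simp
  have htr := trace_mul_adjugate_ne_zero (F.Ω p) (F.indep p hpU) (F.Λ p) (F.μ p) hΛ hlam
    (F.transpose_mul_comm_of_decomp hpU) hinj
  have hH : F.HΩ p ≠ 0 := mul_ne_zero (by norm_num) htr
  have h1 : F.k1Ω p = F.HΩ p - |F.HΩ p| := by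
    rw [Frontal.k1Ω, hlam, zero_mul, sub_zero, Real.sqrt_sq_eq_abs]
  have h2 : F.k2Ω p = F.HΩ p + |F.HΩ p| := by
    rw [Frontal.k2Ω, hlam, zero_mul, sub_zero, Real.sqrt_sq_eq_abs]
  rw [h1, h2]
  rcases hH.lt_or_gt with h | h
  · rw [abs_of_neg h]
    simp [h, h.le, hH]
  · rw [abs_of_pos h]
    simp [h, h.le, hH]
end
end

section
/- Let x : U → ℝ³ be a proper wavefront, Ω a tmb of x, and p ∈ Σ(x) with rank(Dx(p)) = 1. Then |H(u,v)| → ∞ as (u,v) → p through Σ(x)ᶜ, where H is the mean curvature of x on Σ(x)ᶜ. If moreover K_Ω(p) ≠ 0, then |K(u,v)| → ∞ as (u,v) → p through Σ(x)ᶜ, where K is the Gaussian curvature of x on Σ(x)ᶜ. -/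
/- Common framework for frontals and tangent moving bases, following
   "Curvatures on fronts" conventions. -/

noncomputable section

open Matrix Topology Filter

/-- If `n` is orthogonal to the image of `Dx` near `p`, then the bilinear form
`(v, w) ↦ ⟨Dx v, Dn w⟩` is symmetric at `p`. -/
theorem fderiv_dotProduct_fderiv_comm {x n : Pt → Fin 3 → ℝ} {p : Pt}
    (hx : ContDiffAt ℝ 2 x p) (hn : DifferentiableAt ℝ n p)
    (horth : ∀ᶠ q in 𝓝 p, ∀ v, fderiv ℝ x q v ⬝ᵥ n q = 0) (v w : Pt) :
    fderiv ℝ x p v ⬝ᵥ fderiv ℝ n p w = fderiv ℝ x p w ⬝ᵥ fderiv ℝ n p v := by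
  have hdx : DifferentiableAt ℝ (fderiv ℝ x) p :=
    (hx.fderiv_right (m := 1) (by norm_num)).differentiableAt (by norm_num)
  have key : ∀ v w : Pt, fderiv ℝ (fderiv ℝ x) p w v ⬝ᵥ n p
      + fderiv ℝ x p v ⬝ᵥ fderiv ℝ n p w = 0 := by
    intro v w
    have h1 : HasFDerivAt (fun q => fderiv ℝ x q v)
        ((fderiv ℝ (fderiv ℝ x) p).flip v) p := by
      simpa using hdx.hasFDerivAt.clm_apply (hasFDerivAt_const v p)
    have h2 : HasFDerivAt (fun q => fderiv ℝ x q v ⬝ᵥ n q)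
        (∑ i : Fin 3, (fderiv ℝ x p v i • (ContinuousLinearMap.proj i).comp (fderiv ℝ n p)
          + n p i • (ContinuousLinearMap.proj i).comp ((fderiv ℝ (fderiv ℝ x) p).flip v))) p := by
      unfold dotProduct
      exact HasFDerivAt.fun_sum fun i _ =>
        (hasFDerivAt_pi'.1 h1 i).mul (hasFDerivAt_pi'.1 hn.hasFDerivAt i)
    have h3 : HasFDerivAt (fun q => fderiv ℝ x q v ⬝ᵥ n q) (0 : Pt →L[ℝ] ℝ) p :=
      (hasFDerivAt_const (0 : ℝ) p).congr_of_eventuallyEq (horth.mono fun q hq => hq v)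
    have h4 := DFunLike.congr_fun (h2.unique h3) w
    simp only [dotProduct, Fin.sum_univ_three, _root_.add_apply,
      _root_.smul_apply, ContinuousLinearMap.comp_apply,
      ContinuousLinearMap.proj_apply, ContinuousLinearMap.flip_apply, smul_eq_mul,
      _root_.zero_apply] at h4 ⊢
    linarith
  have hsymm := (hx.isSymmSndFDerivAt (by simp)) v w
  have hvw := key v w
  have hwv := key w v
  rw [hsymm] at hwv
  linarith

/-- A nonzero `2 × 2` matrix with left kernel vector `v` and right kernel vector `u` has
`adjugate` proportional to `u vᵀ`; hence `tr (M adj Λ) ≠ 0` as soon as `vᵀ M u ≠ 0`. -/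
theorem trace_mul_adjugate_ne_zero_s8 {Λ M : Matrix (Fin 2) (Fin 2) ℝ} {u v : Fin 2 → ℝ}
    (hΛ : Λ ≠ 0) (hv : v ᵥ* Λ = 0) (hu : Λ *ᵥ u = 0) (hM : v ⬝ᵥ M *ᵥ u ≠ 0) :
    (M * Λ.adjugate).trace ≠ 0 := by
  intro htr
  have v0 := congrFun hv 0
  have v1 := congrFun hv 1
  have u0 := congrFun hu 0
  have u1 := congrFun hu 1
  simp only [vecMul, mulVec, dotProduct, Fin.sum_univ_two, Matrix.trace, Matrix.diag_apply,
    Matrix.mul_apply, adjugate_fin_two, of_apply, cons_val', cons_val_zero, cons_val_one,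
    cons_val_fin_one, Pi.zero_apply] at v0 v1 u0 u1 htr hM
  apply hΛ
  ext i j
  refine (mul_eq_zero.1 ?_).resolve_right hM
  fin_cases i <;> fin_cases j <;> simp <;> grind

/-- The Gram matrix of a `3 × 2` matrix with independent columns is positive definite. -/
theorem gram_posDef {A : Matrix (Fin 3) (Fin 2) ℝ}
    (hA : crossProduct (fun i => A i 0) (fun i => A i 1) ≠ 0) : (Aᵀ * A).PosDef := by
  have hinj : Function.Injective A.mulVec := by
    refine (injective_iff_map_eq_zero A.mulVecLin).2 fun w hw => ?_
    have e0 := congrFun hw 0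
    have e1 := congrFun hw 1
    have e2 := congrFun hw 2
    simp only [mulVecLin_apply, mulVec, dotProduct, Fin.sum_univ_two, Pi.zero_apply] at e0 e1 e2
    by_contra hne
    apply hA
    have hw01 : w 0 ≠ 0 ∨ w 1 ≠ 0 := by
      by_contra! h
      exact hne (by ext i; fin_cases i <;> simp [h])
    rw [cross_apply]
    ext i
    rcases hw01 with h | h <;> refine (mul_eq_zero.1 ?_).resolve_right h <;>
      fin_cases i <;> simp <;> grind
  simpa using Matrix.PosDef.conjTranspose_mul_self A hinj

namespace Frontal

variable (F : Frontal)

theorem Hm_eq {q : Pt} (hq : q ∈ F.reg) : F.Hm q = F.HΩ q / F.lam q := by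
  obtain ⟨hU, hl⟩ := hq
  have hG := (gram_posDef (F.indep q hU)).det_pos.ne'
  have hW : weinOf F.x F.n q = F.μ q * (F.Λ q)⁻¹ := by
    have hΛ : IsUnit (F.Λ q).det := isUnit_iff_ne_zero.2 hl
    have hΛT : IsUnit (F.Λ q)ᵀ.det := by rwa [det_transpose]
    have hG' : IsUnit ((F.Ω q)ᵀ * F.Ω q).det := isUnit_iff_ne_zero.2 hG
    have hI : IOf F.x q = F.Λ q * (((F.Ω q)ᵀ * F.Ω q) * (F.Λ q)ᵀ) := by
      simp only [IOf, F.decomp_x q hU, transpose_mul, transpose_transpose, Matrix.mul_assoc]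
    have hII : (IIOf F.x F.n q)ᵀ = -(F.μ q * (((F.Ω q)ᵀ * F.Ω q) * (F.Λ q)ᵀ)) := by
      simp only [IIOf, Frontal.n, F.decomp_x q hU, F.decomp_n q hU, transpose_mul,
        transpose_neg, transpose_transpose, Matrix.mul_assoc]
    have hB : IsUnit (((F.Ω q)ᵀ * F.Ω q) * (F.Λ q)ᵀ).det := by
      rw [det_mul]; exact hG'.mul hΛT
    rw [weinOf, hI, hII, Matrix.mul_inv_rev, Matrix.neg_mul, neg_neg, Matrix.mul_assoc,
      mul_nonsing_inv_cancel_left _ _ hB]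
  rw [Hm, HmOf, hW, HΩ, αΩ, lam, inv_def, Ring.inverse_eq_inv', Matrix.mul_smul, trace_smul,
    smul_eq_mul]
  ring

theorem Kg_eq {q : Pt} (hq : q ∈ F.reg) : F.Kg q = F.KΩ q / F.lam q := by
  obtain ⟨hU, hl⟩ := hq
  have hG := (gram_posDef (F.indep q hU)).det_pos.ne'
  have hI : IOf F.x q = F.Λ q * ((F.Ω q)ᵀ * F.Ω q) * (F.Λ q)ᵀ := by
    simp only [IOf, F.decomp_x q hU, transpose_mul, transpose_transpose, Matrix.mul_assoc]
  have hII : IIOf F.x F.n q = -(F.Λ q * ((F.Ω q)ᵀ * F.Ω q) * (F.μ q)ᵀ) := by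
    simp only [IIOf, Frontal.n, F.decomp_x q hU, F.decomp_n q hU, transpose_mul,
      transpose_transpose, Matrix.mul_assoc]
  rw [lam] at hl
  rw [Kg, KgOf, hI, hII, KΩ, lam, det_neg]
  simp only [det_mul _ (_)ᵀ, det_mul (F.Λ q), det_transpose, Fintype.card_fin]
  field_simp

theorem fderiv_eq_jac_mulVec {m : ℕ} (f : Pt → Fin m → ℝ) (q v : Pt) :
    fderiv ℝ f q v = jac f q *ᵥ v := by
  have hv : v = v 0 • Pi.single 0 1 + v 1 • Pi.single 1 1 := by
    ext i; fin_cases i <;> simp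
  conv_lhs => rw [hv]
  ext i
  simp [jac, mulVec, dotProduct, Fin.sum_univ_two, mul_comm]

theorem fderiv_x_dotProduct_n {q : Pt} (hq : q ∈ F.U) (v : Pt) :
    fderiv ℝ F.x q v ⬝ᵥ F.n q = 0 := by
  rw [fderiv_eq_jac_mulVec, F.decomp_x q hq, ← mulVec_mulVec]
  simp only [n, normalOf, dotProduct_smul, cross_apply]
  simp [mulVec, dotProduct, Fin.sum_univ_two, Fin.sum_univ_three]
  right
  ring

/-- The matrix `Dxᵀ Dn = Λ (Ωᵀ Ω) μᵀ` is symmetric. -/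
theorem Λ_gram_μ_symm {p : Pt} (hp : p ∈ F.U) :
    F.Λ p * ((F.Ω p)ᵀ * F.Ω p) * (F.μ p)ᵀ = F.μ p * ((F.Ω p)ᵀ * F.Ω p) * (F.Λ p)ᵀ := by
  have hx : ContDiffAt ℝ 2 F.x p :=
    (F.smooth_x.contDiffAt (F.isOpen_U.mem_nhds hp)).of_le (WithTop.coe_le_coe.2 (le_top : (2 : ℕ∞) ≤ ⊤))
  have h : (jac F.x p)ᵀ * jac F.n p = (jac F.n p)ᵀ * jac F.x p := by
    ext i j
    have := fderiv_dotProduct_fderiv_comm hx (F.differentiableAt_n hp)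
      ((F.isOpen_U.eventually_mem hp).mono fun q hq => F.fderiv_x_dotProduct_n hq)
      (Pi.single i 1) (Pi.single j 1)
    rw [dotProduct_comm (fderiv ℝ F.x p (Pi.single j 1))] at this
    exact this
  rw [n, F.decomp_x p hp, F.decomp_n p hp] at h
  simpa only [transpose_mul, transpose_transpose, Matrix.mul_assoc] using h

theorem HΩ_ne_zero (hW : F.IsWavefront) {p : Pt} (hp : p ∈ F.sing)
    (hr : (jac F.x p).rank = 1) : F.HΩ p ≠ 0 := by
  obtain ⟨hU, hl⟩ := hp
  obtain ⟨v, hv0, hv⟩ := exists_vecMul_eq_zero_iff.2 hl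
  have hΛ : F.Λ p ≠ 0 := by
    intro h
    rw [F.decomp_x p hU, h] at hr
    simp at hr
  have hvT : (F.Λ p)ᵀ *ᵥ v = 0 := by rw [mulVec_transpose, hv]
  have hw : (F.μ p)ᵀ *ᵥ v ≠ 0 := by
    intro h
    have hrank := hW p hU
    have hzero : Matrix.fromRows (jac F.x p) (jac F.n p) *ᵥ v = 0 := by
      rw [fromRows_mulVec, n, F.decomp_x p hU, F.decomp_n p hU, ← mulVec_mulVec,
        ← mulVec_mulVec, hvT, h]
      ext i; rcases i with i | i <;> simp
    have hlin := LinearMap.finrank_range_add_finrank_ker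
      (Matrix.fromRows (jac F.x p) (jac F.n p)).mulVecLin
    rw [← Matrix.rank, hrank, Module.finrank_fin_fun] at hlin
    have hker := Submodule.finrank_eq_zero.1 (Nat.add_left_cancel hlin)
    exact hv0 ((LinearMap.ker_eq_bot'.1 hker) v hzero)
  have hu : F.Λ p *ᵥ (((F.Ω p)ᵀ * F.Ω p) *ᵥ ((F.μ p)ᵀ *ᵥ v)) = 0 := by
    rw [mulVec_mulVec, mulVec_mulVec, F.Λ_gram_μ_symm hU, ← mulVec_mulVec, hvT, mulVec_zero]
  have hpos := (gram_posDef (F.indep p hU)).dotProduct_mulVec_pos hw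
  refine mul_ne_zero (by norm_num) (trace_mul_adjugate_ne_zero_s8 hΛ hv hu ?_)
  rw [dotProduct_mulVec, ← mulVec_transpose]
  exact hpos.ne'

theorem continuousAt_Λ {p : Pt} (hp : p ∈ F.U) : ContinuousAt F.Λ p :=
  continuousAt_pi.2 fun i => continuousAt_pi.2 fun j =>
    ((F.smooth_Λ i j).contDiffAt (F.isOpen_U.mem_nhds hp)).continuousAt

theorem continuousAt_μ {p : Pt} (hp : p ∈ F.U) : ContinuousAt F.μ p :=
  continuousAt_pi.2 fun i => continuousAt_pi.2 fun j =>
    ((F.smooth_μ i j).contDiffAt (F.isOpen_U.mem_nhds hp)).continuousAt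

theorem continuousAt_lam {p : Pt} (hp : p ∈ F.U) : ContinuousAt F.lam p :=
  (continuous_id.matrix_det.continuousAt (x := F.Λ p)).comp (F.continuousAt_Λ hp)

theorem continuousAt_KΩ {p : Pt} (hp : p ∈ F.U) : ContinuousAt F.KΩ p :=
  (continuous_id.matrix_det.continuousAt (x := F.μ p)).comp (F.continuousAt_μ hp)

theorem continuousAt_HΩ {p : Pt} (hp : p ∈ F.U) : ContinuousAt F.HΩ p := by
  have h : Continuous fun M : Matrix (Fin 2) (Fin 2) ℝ × Matrix (Fin 2) (Fin 2) ℝ =>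
      -(1 / 2 : ℝ) * (M.1 * M.2.adjugate).trace :=
    continuous_const.mul (continuous_fst.matrix_mul continuous_snd.matrix_adjugate).matrix_trace
  exact h.continuousAt.comp (f := fun q => (F.μ q, F.Λ q)) (x := p)
    ((F.continuousAt_μ hp).prodMk (F.continuousAt_Λ hp))

theorem tendsto_abs_div_lam {p : Pt} (hp : p ∈ F.sing) {φ : Pt → ℝ} (hφ : ContinuousAt φ p)
    (hφp : φ p ≠ 0) : Tendsto (fun q => |φ q / F.lam q|) (𝓝[F.reg] p) atTop := by
  have hlam : Tendsto F.lam (𝓝[F.reg] p) (𝓝[≠] 0) := by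
    refine tendsto_nhdsWithin_iff.2 ⟨?_, eventually_mem_nhdsWithin.mono fun q hq => hq.2⟩
    have := (F.continuousAt_lam hp.1).tendsto.mono_left (nhdsWithin_le_nhds (s := F.reg))
    rwa [hp.2] at this
  have hinv : Tendsto (fun q => |F.lam q|⁻¹) (𝓝[F.reg] p) atTop := by
    simpa [Function.comp_def] using (tendsto_norm_inv_nhdsNE_zero_atTop (α := ℝ)).comp hlam
  simp only [div_eq_mul_inv, abs_mul, abs_inv]
  exact Tendsto.pos_mul_atTop (abs_pos.2 hφp)
    (hφ.abs.tendsto.mono_left nhdsWithin_le_nhds) hinv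

end Frontal

/-- At a rank-1 singularity of a proper wavefront, `|H| → ∞` at `p`
through the regular set; if moreover `K_Ω(p) ≠ 0` then `|K| → ∞` as well. -/
theorem stmt8 (F : Frontal) (hW : F.IsWavefront) (hP : F.IsProper)
    (p : Pt) (hp : p ∈ F.sing) (hr : (jac F.x p).rank = 1) :
    Tendsto (fun q => |F.Hm q|) (nhdsWithin p F.reg) atTop ∧
    (F.KΩ p ≠ 0 → Tendsto (fun q => |F.Kg q|) (nhdsWithin p F.reg) atTop) := by
  refine ⟨?_, fun hK => ?_⟩
  · refine (F.tendsto_abs_div_lam hp (F.continuousAt_HΩ hp.1) (F.HΩ_ne_zero hW hp hr)).congr' ?_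
    exact eventually_mem_nhdsWithin.mono fun q hq => by simp only [F.Hm_eq hq]
  · refine (F.tendsto_abs_div_lam hp (F.continuousAt_KΩ hp.1) hK).congr' ?_
    exact eventually_mem_nhdsWithin.mono fun q hq => by simp only [F.Kg_eq hq]
end
end
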